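/- arXiv:1107.2102 — 2 statements merged into one kernel-verified Lean document; each statement's English description precedes it below -/
import Mathlib

section
/- Let N be an R-module such that the local cohomology modules H^s_𝔞(N) vanish for all s ≥ 0, where 𝔞 is an ideal of the commutative Noetherian ring R. Then Ext^i_R(R/𝔞, N) = 0 for all i ≥ 0. -/
noncomputable section
open CategoryTheory

namespace Paper

variable (R : Type) [CommRing R]

/-- The `i`-th local cohomology of the `R`-module `M` with respect to the ideal `I`. -/
abbrev H (I : Ideal R) (i : ℕ) (M : Type) [AddCommGroup M] [Module R M] : ModuleCat R :=
  (localCohomology I i).obj (ModuleCat.of R M)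

/-- `N` is a `p`-secondary submodule of `M`: it is nonzero, every `r : R` acts on it either
surjectively or nilpotently, and `p` is the radical of its annihilator. -/
def IsSecondaryFor {M : Type} [AddCommGroup M] [Module R M]
    (N : Submodule R M) (p : Ideal R) : Prop :=
  N ≠ ⊥ ∧
  (∀ r : R, (∀ m ∈ N, ∃ n ∈ N, r • n = m) ∨ (∃ k : ℕ, ∀ m ∈ N, r ^ k • m = 0)) ∧
  N.annihilator.radical = p

/-- A minimal secondary representation of the module `M`. -/
structure MinSecRep (M : Type) [AddCommGroup M] [Module R M] where
  n : ℕ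
  S : Fin n → Submodule R M
  p : Fin n → Ideal R
  prime : ∀ i, (p i).IsPrime
  sec : ∀ i, IsSecondaryFor R (S i) (p i)
  sum : (⨆ i, S i) = ⊤
  inj : Function.Injective p
  irred : ∀ j, ¬ (S j ≤ ⨆ i ∈ ({j}ᶜ : Set (Fin n)), S i)

/-- `M` is representable: it is a (finite) sum of secondary submodules. -/
def IsRepresentable (M : Type) [AddCommGroup M] [Module R M] : Prop :=
  ∃ (n : ℕ) (S : Fin n → Submodule R M) (p : Fin n → Ideal R),
    (∀ i, (p i).IsPrime) ∧ (∀ i, IsSecondaryFor R (S i) (p i)) ∧ (⨆ i, S i) = ⊤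

/-- The set of attached primes of `M`: the primes occurring in a minimal secondary
representation of `M`. -/
def attached (M : Type) [AddCommGroup M] [Module R M] : Set (Ideal R) :=
  {q | ∃ (rep : MinSecRep R M) (i : Fin rep.n), rep.p i = q}

/-- The coheight (dimension of `R/I`): Krull dimension of the set of primes containing `I`. -/
def coheight (I : Ideal R) : WithBot ℕ∞ :=
  Order.krullDim {p : Ideal R // p.IsPrime ∧ I ≤ p}

/-- The Krull dimension of the ring `R`. -/
def ringDim : WithBot ℕ∞ := Order.krullDim {p : Ideal R // p.IsPrime}

/-- The Krull dimension of (the support of) the finitely generated module `M`. -/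
def dimMod (M : Type) [AddCommGroup M] [Module R M] : WithBot ℕ∞ :=
  coheight R (Module.annihilator R M)

/-- The dimension of the localized module `M_q`: chains of primes in the support of `M`
contained in `q`. -/
def dimModAt (M : Type) [AddCommGroup M] [Module R M] (q : Ideal R) : WithBot ℕ∞ :=
  Order.krullDim {p : Ideal R // p.IsPrime ∧ Module.annihilator R M ≤ p ∧ p ≤ q}

/-- The support of a finitely generated module: primes containing the annihilator. -/
def supp (M : Type) [AddCommGroup M] [Module R M] : Set (Ideal R) :=
  {p | p.IsPrime ∧ Module.annihilator R M ≤ p}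

/-- `Min M`: minimal primes of the support of `M`. -/
def minSupp (M : Type) [AddCommGroup M] [Module R M] : Set (Ideal R) :=
  (Module.annihilator R M).minimalPrimes

/-- `Assh M`: primes in the support of maximal coheight. -/
def assh (M : Type) [AddCommGroup M] [Module R M] : Set (Ideal R) :=
  {p | p ∈ supp R M ∧ coheight R p = dimMod R M}

open RingTheory.Sequence in
/-- Depth of `M` with respect to the ideal `J`: supremum of the lengths of `M`-regular
sequences contained in `J`. -/
def depthOn (J : Ideal R) (M : Type) [AddCommGroup M] [Module R M] : ℕ∞ :=
  ⨆ l ∈ {l : List R | (∀ x ∈ l, x ∈ J) ∧ IsRegular M l}, (l.length : ℕ∞)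

/-- `M` is a Cohen–Macaulay module over the local ring `R`: depth = dimension. -/
def IsCMLocalMod [IsLocalRing R] (M : Type) [AddCommGroup M] [Module R M] : Prop :=
  (depthOn R (IsLocalRing.maximalIdeal R) M : WithBot ℕ∞) = dimMod R M

/-- `R` is a Cohen–Macaulay local ring: it is local and its depth (w.r.t. its Jacobson
radical, which is the maximal ideal) equals its Krull dimension. -/
def IsCMLocalRing : Prop :=
  IsLocalRing R ∧ ((depthOn R ((⊥ : Ideal R).jacobson) R : WithBot ℕ∞) = ringDim R)

/-- `R` is a Cohen–Macaulay ring: all of its localizations at primes are CM local rings. -/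
def IsCMRing : Prop :=
  ∀ (p : Ideal R) [p.IsPrime], IsCMLocalRing (Localization.AtPrime p)

/-- `M` is an equidimensional module: every minimal prime of its support has coheight equal
to the dimension of `M`. -/
def IsEquidim (M : Type) [AddCommGroup M] [Module R M] : Prop :=
  ∀ q ∈ minSupp R M, coheight R q = dimMod R M

/-- `R` is catenary: any two saturated chains of primes with the same endpoints have the
same length. -/
def IsCatenary : Prop :=
  ∀ (c₁ c₂ : LTSeries {p : Ideal R // p.IsPrime}),
    c₁.head = c₂.head → c₁.last = c₂.last →
    (∀ i : Fin c₁.length, c₁.toFun i.castSucc ⋖ c₁.toFun i.succ) →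
    (∀ i : Fin c₂.length, c₂.toFun i.castSucc ⋖ c₂.toFun i.succ) →
    c₁.length = c₂.length

/-- `R` is universally catenary: every finitely generated `R`-algebra is catenary. -/
def IsUnivCatenary : Prop :=
  ∀ (A : Type) [CommRing A] [Algebra R A], Algebra.FiniteType R A → IsCatenary A

/-- `x` is a uniform local cohomological annihilator of `M`: `x` avoids all minimal primes
of `M` and, for every maximal ideal `m`, kills `H^i_m(M)` for all `i < dim M_m`. -/
def IsULCA (M : Type) [AddCommGroup M] [Module R M] (x : R) : Prop :=
  (∀ p ∈ minSupp R M, x ∉ p) ∧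
  ∀ (m : Ideal R), m.IsMaximal → ∀ i : ℕ, (i : WithBot ℕ∞) < dimModAt R M m →
    ∀ y : H R m i M, x • y = 0

/-- `M` has a uniform local cohomological annihilator. -/
def HasULCA (M : Type) [AddCommGroup M] [Module R M] : Prop := ∃ x, IsULCA R M x

/-- `R/p` has a uniform local cohomological annihilator (local case): some `x ∉ p` kills
`H^i_𝔪(R/p)` for all `i < dim R/p`. -/
def HasULCAQuot [IsLocalRing R] (p : Ideal R) : Prop :=
  ∃ x ∉ p, ∀ i : ℕ, (i : WithBot ℕ∞) < coheight R p →
    ∀ y : H R (IsLocalRing.maximalIdeal R) i (R ⧸ p), x • y = 0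

/-- `M` is generalized Cohen–Macaulay over the local ring `R`: a power of the maximal ideal
kills all local cohomology below the dimension. -/
def IsGCM [IsLocalRing R] (M : Type) [AddCommGroup M] [Module R M] : Prop :=
  ∃ n : ℕ, ∀ i : ℕ, (i : WithBot ℕ∞) < dimMod R M →
    ∀ a ∈ (IsLocalRing.maximalIdeal R) ^ n,
      ∀ y : H R (IsLocalRing.maximalIdeal R) i M, a • y = 0

end Paper

universe u

open Abelian in
theorem Ext_eq_zero_of_mk₀_comp_eq_zero {R : Type u} [CommRing R] {M L : Type u}
    [AddCommGroup M] [Module R M] [AddCommGroup L] [Module R L] {f : M →ₗ[R] L}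
    (hf : Function.Surjective f) (Y : ModuleCat.{u} R) (j : ℕ)
    (hker : ∀ k, 1 + k = j → Subsingleton (Ext (ModuleCat.of R (LinearMap.ker f)) Y k))
    (x : Ext (ModuleCat.of R L) Y j)
    (hx : (Ext.mk₀ (ModuleCat.ofHom f)).comp x (zero_add j) = 0) : x = 0 := by
  cases j with
  | zero =>
    have : Epi (ModuleCat.ofHom f) := (ModuleCat.epi_iff_surjective _).mpr hf
    refine Ext.precomp_mk₀_injective_of_epi Y (ModuleCat.ofHom f) ?_
    rw [map_zero]
    exact hx
  | succ k =>
    have hk := hker k (Nat.add_comm 1 k)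
    obtain ⟨y, rfl⟩ := Ext.contravariant_sequence_exact₃
      (LinearMap.shortExact_shortComplexKer hf) Y x hx (Nat.add_comm 1 k)
    rw [hk.elim y 0, Ext.comp_zero]

open Abelian in
/-- If `Ext^j(R/a, Y) = 0` for all `j < n`, then `Ext^j(M, Y) = 0` for all `j < n` and all finitely
generated modules `M` killed by a power of `a`. -/
theorem Ext_subsingleton_of_pow_le_annihilator {R : Type u} [CommRing R] [IsNoetherianRing R]
    (a : Ideal R) (Y : ModuleCat.{u} R) (n : ℕ)
    (h : ∀ j < n, Subsingleton (Ext (ModuleCat.of R (R ⧸ a)) Y j)) (j : ℕ) (hj : j < n)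
    (M : Type u) [AddCommGroup M] [Module R M] [hM : Module.Finite R M] (t : ℕ)
    (ht : a ^ t ≤ Module.annihilator R M) : Subsingleton (Ext (ModuleCat.of R M) Y j) := by
  induction j using Nat.strong_induction_on generalizing M t with
  | _ j ih =>
  revert t
  induction hM using IsNoetherianRing.induction_on_isQuotientEquivQuotientPrime with
  | subsingleton N =>
    intro t _
    have hid : 𝟙 (ModuleCat.of R N) = 0 := (ModuleCat.isZero_of_subsingleton _).eq_of_src _ _
    refine subsingleton_of_forall_eq 0 fun x ↦ ?_
    rw [← Ext.mk₀_id_comp x, hid, Ext.mk₀_zero, Ext.zero_comp]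
  | quotient N p e =>
    intro t ht
    have hp : a ≤ p.1 := by
      have hle : a ^ t ≤ p.1 := ht.trans (by rw [e.annihilator_eq, Ideal.annihilator_quotient])
      exact p.2.le_of_pow_le hle
    let f : (R ⧸ a) →ₗ[R] N := e.symm.toLinearMap ∘ₗ Submodule.factor hp
    have hf : Function.Surjective f :=
      e.symm.surjective.comp (Submodule.factor_surjective hp)
    have := h j hj
    refine subsingleton_of_forall_eq 0 fun x ↦
      Ext_eq_zero_of_mk₀_comp_eq_zero hf Y j (fun k hk ↦ ?_) x (Subsingleton.elim _ _)
    refine ih k (by lia) (by lia) (LinearMap.ker f) 1 ?_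
    rw [pow_one]
    calc a = Module.annihilator R (R ⧸ a) := Ideal.annihilator_quotient.symm
      _ ≤ _ := LinearMap.annihilator_le_of_injective _ (LinearMap.ker f).injective_subtype
  | exact N₁ N₂ N₃ f g hf hg hfg h₁ h₃ =>
    intro t ht
    have hs₁ := h₁ t (ht.trans (LinearMap.annihilator_le_of_injective f hf))
    have hs₃ := h₃ t (ht.trans (LinearMap.annihilator_le_of_surjective g hg))
    let S : ShortComplex (ModuleCat.{u} R) :=
      ShortComplex.mk (ModuleCat.ofHom f) (ModuleCat.ofHom g)
        (by rw [← ModuleCat.ofHom_comp, hfg.linearMap_comp_eq_zero]; rfl)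
    have hS : S.ShortExact :=
      { exact := (ShortComplex.ShortExact.moduleCat_exact_iff_function_exact _).mpr hfg
        mono_f := (ModuleCat.mono_iff_injective _).mpr hf
        epi_g := (ModuleCat.epi_iff_surjective _).mpr hg }
    refine subsingleton_of_forall_eq 0 fun x ↦ ?_
    obtain ⟨y, rfl⟩ := Ext.contravariant_sequence_exact₂ hS Y x (hs₁.elim _ _)
    rw [hs₃.elim y 0, Ext.comp_zero]

open Abelian in
theorem Ext_eq_zero_of_factor_comp_eq_zero {R : Type u} [CommRing R] [IsNoetherianRing R]
    (a : Ideal R) (Y : ModuleCat.{u} R) (n : ℕ)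
    (h : ∀ j < n, Subsingleton (Ext (ModuleCat.of R (R ⧸ a)) Y j)) {b c : Ideal R} (hbc : b ≤ c)
    (t : ℕ) (hb : a ^ t ≤ b) (x : Ext (ModuleCat.of R (R ⧸ c)) Y n)
    (hx : (Ext.mk₀ (ModuleCat.ofHom (Submodule.factor hbc))).comp x (zero_add n) = 0) :
    x = 0 := by
  refine Ext_eq_zero_of_mk₀_comp_eq_zero (Submodule.factor_surjective hbc) Y n (fun k hk ↦ ?_)
    x hx
  refine Ext_subsingleton_of_pow_le_annihilator a Y n h k (by lia) _ t (hb.trans ?_)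
  calc b = Module.annihilator R (R ⧸ b) := Ideal.annihilator_quotient.symm
    _ ≤ _ := LinearMap.annihilator_le_of_injective _ (LinearMap.ker _).injective_subtype

/-- The morphism of cochain complexes `Hom(Q, Y) ⟶ Hom(P, Y)` induced by a chain map `P ⟶ Q`. -/
def ChainComplex.linearYonedaObjMap {R : Type*} [Ring R] {C : Type*} [Category* C] [Abelian C]
    [Linear R C] {P Q : ChainComplex C ℕ} (F : P ⟶ Q) (Y : C) :
    Q.linearYonedaObj R Y ⟶ P.linearYonedaObj R Y :=
  (HomologicalComplex.unopFunctor _ _).map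
    ((((linearYoneda R C).obj Y).rightOp.mapHomologicalComplex _).map F).op

theorem CategoryTheory.ProjectiveResolution.isoExt_hom_naturality
    {R : Type*} [Ring R] {C : Type*} [Category* C] [Abelian C]
    [Linear R C] [EnoughProjectives C] {X X' : C} (f : X ⟶ X') (P : ProjectiveResolution X)
    (Q : ProjectiveResolution X') (F : P.complex ⟶ Q.complex)
    (comm : F.f 0 ≫ Q.π.f 0 = P.π.f 0 ≫ f) (n : ℕ) (Y : C) :
    ((Ext R C n).map f.op).app Y ≫ (P.isoExt n Y).hom =
      (Q.isoExt n Y).hom ≫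
        HomologicalComplex.homologyMap (ChainComplex.linearYonedaObjMap F Y) n := by
  have h₁ := P.isoLeftDerivedObj_inv_naturality f Q F comm ((linearYoneda R C).obj Y).rightOp n
  have h₂ := HomologicalComplex.homologyOp_hom_naturality
    (ChainComplex.linearYonedaObjMap (R := R) F Y) n
  have h₃ : ∀ {D : Type _} [Category D] {A A' B B' E E' : D} (α : A ≅ B) (α' : A' ≅ B')
      (β : B ≅ E) (β' : B' ≅ E') (L : A ⟶ A') (M : B ⟶ B') (m : E ⟶ E'),
      α.inv ≫ L = M ≫ α'.inv → M ≫ β'.hom = β.hom ≫ m →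
      β.inv ≫ α.inv ≫ L = m ≫ β'.inv ≫ α'.inv := by
    intro D _ A A' B B' E E' α α' β β' L M m e₁ e₂
    rw [e₁, Iso.inv_comp_eq, ← reassoc_of% e₂, Iso.hom_inv_id_assoc]
  exact congr_arg Quiver.Hom.unop (h₃ (P.isoLeftDerivedObj ((linearYoneda R C).obj Y).rightOp n)
    (Q.isoLeftDerivedObj ((linearYoneda R C).obj Y).rightOp n)
    (HomologicalComplex.homologyOp (P.complex.linearYonedaObj R Y) n)
    (HomologicalComplex.homologyOp (Q.complex.linearYonedaObj R Y) n) _ _ _ h₁ h₂)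

theorem HomologicalComplex.moduleCat_homologyπ_eq_zero_iff {R : Type*} [Ring R] {ι : Type*}
    {c : ComplexShape ι} (K : HomologicalComplex (ModuleCat R) c) (n : ι) (z : K.cycles n) :
    K.homologyπ n z = 0 ↔ ∃ g : K.X (c.prev n), K.d (c.prev n) n g = K.iCycles n z := by
  have hex : (ShortComplex.mk _ _ (K.toCycles_comp_homologyπ (c.prev n) n)).Exact :=
    ShortComplex.exact_of_g_is_cokernel _ (K.homologyIsCokernel (c.prev n) n rfl)
  have hinj : Function.Injective (K.iCycles n) := (ModuleCat.mono_iff_injective _).mp inferInstance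
  rw [ShortComplex.moduleCat_exact_iff] at hex
  have hcomp (g : K.X (c.prev n)) :
      K.iCycles n (K.toCycles (c.prev n) n g) = K.d (c.prev n) n g := by
    rw [← ConcreteCategory.comp_apply, K.toCycles_i]
  constructor
  · intro h
    obtain ⟨g, hg⟩ := hex z h
    exact ⟨g, by rw [← hcomp]; exact congr_arg _ hg⟩
  · rintro ⟨g, hg⟩
    rw [← hcomp] at hg
    rw [← hinj hg, ← ConcreteCategory.comp_apply, K.toCycles_comp_homologyπ]
    rfl

namespace CategoryTheory.ProjectiveResolution

section

variable {R : Type*} [Ring R] {C : Type*} [Category* C] [Abelian C]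
  [Linear R C]

variable (R) in
/-- The cycle of `Hom(P, Y)` given by a morphism `P_n ⟶ Y` vanishing on boundaries. -/
def linearYonedaCycle {X : C} (P : ProjectiveResolution X) {Y : C} {n : ℕ}
    (φ : P.complex.X n ⟶ Y) (hφ : P.complex.d (n + 1) n ≫ φ = 0) :
    (P.complex.linearYonedaObj R Y).cycles n :=
  (P.complex.linearYonedaObj R Y).cyclesMk φ (n + 1) (by simp)
    (by rw [ChainComplex.linearYonedaObj_d]; exact hφ)

theorem iCycles_linearYonedaCycle {X : C} (P : ProjectiveResolution X) {Y : C} {n : ℕ}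
    (φ : P.complex.X n ⟶ Y) (hφ : P.complex.d (n + 1) n ≫ φ = 0) :
    (P.complex.linearYonedaObj R Y).iCycles n (P.linearYonedaCycle R φ hφ) = φ :=
  (P.complex.linearYonedaObj R Y).i_cyclesMk φ (n + 1) _ _

variable [EnoughProjectives C]

variable (R) in
/-- The class in `Ext R C n` of a cocycle of a projective resolution. -/
def leftDerivedExtMk {X : C} (P : ProjectiveResolution X) {Y : C} {n : ℕ} (φ : P.complex.X n ⟶ Y)
    (hφ : P.complex.d (n + 1) n ≫ φ = 0) : ((Ext R C n).obj (Opposite.op X)).obj Y :=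
  (P.isoExt n Y).inv ((P.complex.linearYonedaObj R Y).homologyπ n
    (P.linearYonedaCycle R φ hφ))

theorem leftDerivedExtMk_surjective {X : C} (P : ProjectiveResolution X) {Y : C} {n : ℕ}
    (x : ((Ext R C n).obj (Opposite.op X)).obj Y) :
    ∃ (φ : P.complex.X n ⟶ Y) (hφ : P.complex.d (n + 1) n ≫ φ = 0),
      P.leftDerivedExtMk R φ hφ = x := by
  obtain ⟨z, hz⟩ := (ModuleCat.epi_iff_surjective _).mp
    (inferInstance : Epi ((P.complex.linearYonedaObj R Y).homologyπ n)) ((P.isoExt n Y).hom x)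
  let φ : P.complex.X n ⟶ Y := (P.complex.linearYonedaObj R Y).iCycles n z
  have hφ : P.complex.d (n + 1) n ≫ φ = 0 := by
    have h : (P.complex.linearYonedaObj R Y).d n (n + 1)
        ((P.complex.linearYonedaObj R Y).iCycles n z) = 0 := by
      rw [← ConcreteCategory.comp_apply, HomologicalComplex.iCycles_d]
      rfl
    rw [ChainComplex.linearYonedaObj_d] at h
    exact h
  refine ⟨φ, hφ, ?_⟩
  have hcyc : P.linearYonedaCycle R φ hφ = z :=
    (ModuleCat.mono_iff_injective _).mp
      (inferInstance : Mono ((P.complex.linearYonedaObj R Y).iCycles n))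
      (P.iCycles_linearYonedaCycle φ hφ)
  rw [leftDerivedExtMk, hcyc, hz]
  exact (P.isoExt n Y).hom_inv_id_apply x

theorem leftDerivedExtMk_eq_zero_iff {X : C} (P : ProjectiveResolution X) {Y : C} {n : ℕ}
    (φ : P.complex.X n ⟶ Y) (hφ : P.complex.d (n + 1) n ≫ φ = 0) :
    P.leftDerivedExtMk R φ hφ = 0 ↔ ∃ g : P.complex.X ((ComplexShape.up ℕ).prev n) ⟶ Y,
      P.complex.d n _ ≫ g = φ := by
  have hinj : Function.Injective (P.isoExt (R := R) n Y).inv :=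
    (ModuleCat.mono_iff_injective _).mp inferInstance
  rw [leftDerivedExtMk, map_eq_zero_iff _ hinj,
    HomologicalComplex.moduleCat_homologyπ_eq_zero_iff, iCycles_linearYonedaCycle,
    ChainComplex.linearYonedaObj_d]
  rfl

theorem map_leftDerivedExtMk {X X' : C} {f : X ⟶ X'} {P : ProjectiveResolution X}
    {Q : ProjectiveResolution X'} (F : P.Hom Q f) {Y : C} {n : ℕ}
    (φ : Q.complex.X n ⟶ Y) (hφ : Q.complex.d (n + 1) n ≫ φ = 0) :
    ((Ext R C n).map f.op).app Y (Q.leftDerivedExtMk R φ hφ) =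
      P.leftDerivedExtMk R (F.hom.f n ≫ φ) (by simp [← F.hom.comm_assoc, hφ]) := by
  have hnat := isoExt_hom_naturality (R := R) f P Q F.hom
    (F.hom_f_zero_comp_π_f_zero.trans (by simp)) n Y
  rw [← Iso.eq_comp_inv, Category.assoc, ← Iso.inv_comp_eq] at hnat
  have hcyc : HomologicalComplex.cyclesMap (ChainComplex.linearYonedaObjMap F.hom Y) n
      (Q.linearYonedaCycle R φ hφ) =
      P.linearYonedaCycle R (F.hom.f n ≫ φ) (by simp [← F.hom.comm_assoc, hφ]) := by
    apply (ModuleCat.mono_iff_injective _).mp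
      (inferInstance : Mono ((P.complex.linearYonedaObj R Y).iCycles n))
    rw [iCycles_linearYonedaCycle, ← ConcreteCategory.comp_apply,
      HomologicalComplex.cyclesMap_i, ConcreteCategory.comp_apply, iCycles_linearYonedaCycle]
    rfl
  have hπ := ConcreteCategory.congr_hom (HomologicalComplex.homologyπ_naturality
    (ChainComplex.linearYonedaObjMap (R := R) F.hom Y) n) (Q.linearYonedaCycle R φ hφ)
  rw [ConcreteCategory.comp_apply, ConcreteCategory.comp_apply, hcyc] at hπ
  rw [leftDerivedExtMk, leftDerivedExtMk, ← hπ]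
  exact ConcreteCategory.congr_hom hnat _

end

section

open Limits CochainComplex.HomComplex

variable {C : Type*} [Category* C] [Abelian C] [HasExt C]

theorem extMk_eq_zero_iff_exists {X : C} (P : ProjectiveResolution X) {Y : C} {n : ℕ}
    (φ : P.complex.X n ⟶ Y) (hφ : P.complex.d (n + 1) n ≫ φ = 0) :
    P.extMk φ (n + 1) rfl hφ = 0 ↔ ∃ g : P.complex.X ((ComplexShape.up ℕ).prev n) ⟶ Y,
      P.complex.d n _ ≫ g = φ := by
  cases n with
  | succ p => rw [P.extMk_eq_zero_iff φ _ rfl hφ p rfl, CochainComplex.prev_nat_succ]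
  | zero =>
    refine ⟨fun h ↦ ⟨0, ?_⟩, ?_⟩
    · simp only [← P.extEquivCohomologyClass.apply_eq_iff_eq,
        extEquivCohomologyClass_extMk, extEquivCohomologyClass_zero,
        CohomologyClass.mk_eq_zero_iff] at h
      rw [Cocycle.toSingleMk_mem_coboundaries_iff _ _ _ _ _ 1 (by simp)] at h
      obtain ⟨g, hg⟩ := h
      rw [(P.cochainComplex.isZero_of_isStrictlyLE 0 1 (by lia)).eq_of_src g 0, comp_zero] at hg
      rw [comp_zero, ← cancel_epi (P.cochainComplexXIso (-(0 : ℕ)) 0 rfl).hom, comp_zero]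
      exact hg
    · rintro ⟨g, rfl⟩
      simp

end

section

variable {R : Type*} [Ring R] {C : Type*} [Category* C] [Abelian C]
  [Linear R C] [EnoughProjectives C] [HasExt C]

theorem subsingleton_Ext_of_subsingleton {X Y : C} {n : ℕ} [Subsingleton (Abelian.Ext X Y n)] :
    Subsingleton (((Ext R C n).obj (Opposite.op X)).obj Y) := by
  refine subsingleton_of_forall_eq 0 fun x ↦ ?_
  obtain ⟨φ, hφ, rfl⟩ := (ProjectiveResolution.of X).leftDerivedExtMk_surjective x
  rw [leftDerivedExtMk_eq_zero_iff, ← extMk_eq_zero_iff_exists _ φ hφ]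
  exact Subsingleton.elim _ _

/-- Every class in `Abelian.Ext X Y n` has a counterpart in `Ext R C n` such that pulling back the
latter to zero along a morphism also pulls back the former to zero. -/
theorem exists_forall_mk₀_comp_eq_zero {X Y : C} {n : ℕ} (x : Abelian.Ext X Y n) :
    ∃ y : ((Ext R C n).obj (Opposite.op X)).obj Y, ∀ {W : C} (f : W ⟶ X),
      ((Ext R C n).map f.op).app Y y = 0 → (Abelian.Ext.mk₀ f).comp x (zero_add n) = 0 := by
  let P := ProjectiveResolution.of X
  obtain ⟨φ, hφ, rfl⟩ := P.extMk_surjective x (n + 1) rfl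
  refine ⟨P.leftDerivedExtMk R φ hφ, fun {W} f hf ↦ ?_⟩
  let F : (ProjectiveResolution.of W).Hom P f :=
    { hom := ProjectiveResolution.lift f _ _
      hom_f_zero_comp_π_f_zero := by simpa using ProjectiveResolution.lift_commutes_zero f _ _ }
  rw [map_leftDerivedExtMk F, leftDerivedExtMk_eq_zero_iff] at hf
  rwa [mk₀_comp_extMk φ _ rfl hφ F, extMk_eq_zero_iff_exists]

end

end CategoryTheory.ProjectiveResolution

open Limits in
/-- If `H^i_a(Y) = 0`, then every element of `Ext^i(R/a^s, Y)` dies in some `Ext^i(R/a^t, Y)`. -/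
theorem localCohomology.exists_Ext_map_factor_eq_zero {R : Type u} [CommRing R] (a : Ideal R)
    (i : ℕ) (Y : ModuleCat.{u} R) [Subsingleton ((localCohomology a i).obj Y)] (s : ℕ)
    (y : ((Ext R (ModuleCat R) i).obj (Opposite.op (ModuleCat.of R (R ⧸ a ^ s)))).obj Y) :
    ∃ (t : ℕ) (ht : a ^ t ≤ a ^ s), ((Ext R (ModuleCat R) i).map
      (ModuleCat.ofHom (Submodule.factor ht)).op).app Y y = 0 := by
  let D := localCohomology.diagram (localCohomology.idealPowersDiagram a) i
  let E := (evaluation (ModuleCat.{u} R) (ModuleCat.{u} R)).obj Y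
  have hE : IsColimit (E.mapCocone (colimit.cocone D)) :=
    isColimitOfPreserves E (colimit.isColimit D)
  have hsub : Subsingleton (E.mapCocone (colimit.cocone D)).pt :=
    inferInstanceAs (Subsingleton ((localCohomology a i).obj Y))
  have : PreservesFilteredColimitsOfSize.{0, 0} (forget (ModuleCat.{u} R)) :=
    preservesSmallestFilteredColimits_of_preservesFilteredColimits _
  obtain ⟨k, f, g, h⟩ := Concrete.isColimit_exists_of_rep_eq (F := D ⋙ E)
    (i := Opposite.op (Opposite.op s)) (j := Opposite.op (Opposite.op s)) hE y 0
    (hsub.elim _ _)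
  exact ⟨k.unop.unop, ((localCohomology.idealPowersDiagram a).map f.unop).down.down,
    h.trans (map_zero _)⟩

/-- If all local cohomology modules `H^s_a(N)` vanish, then `Ext^i_R(R/a, N) = 0` for all
`i ≥ 0`. -/
theorem ext_vanishing_of_localCohomology_vanishing (R : Type) [CommRing R]
    [IsNoetherianRing R] (a : Ideal R) (N : Type) [AddCommGroup N] [Module R N]
    (hvan : ∀ s : ℕ, Subsingleton (Paper.H R a s N)) :
    ∀ i : ℕ, Subsingleton (((Ext R (ModuleCat R) i).obj
      (Opposite.op (ModuleCat.of R (R ⧸ a)))).obj (ModuleCat.of R N)) := by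
  have key (i : ℕ) :
      Subsingleton (Abelian.Ext (ModuleCat.of R (R ⧸ a ^ 1)) (ModuleCat.of R N) i) := by
    induction i using Nat.strong_induction_on with
    | _ i ih =>
    refine subsingleton_of_forall_eq 0 fun x ↦ ?_
    obtain ⟨y, hy⟩ := ProjectiveResolution.exists_forall_mk₀_comp_eq_zero (R := R) x
    have := hvan i
    obtain ⟨t, ht, hyt⟩ := localCohomology.exists_Ext_map_factor_eq_zero a i
      (ModuleCat.of R N) 1 y
    exact Ext_eq_zero_of_factor_comp_eq_zero (a ^ 1) _ i ih ht t (by rw [pow_one]) x (hy _ hyt)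
  rw [pow_one] at key
  intro i
  have := key i
  exact ProjectiveResolution.subsingleton_Ext_of_subsingleton
end
end

section
/- Let (R,𝔪) be a Noetherian local ring and M a nonzero finitely generated R-module with dim M = 1. Then for any subset T of Assh M, setting 𝔞 = ⋂_{𝔭 ∈ Assh M \ T} 𝔭 (with 𝔞 = 𝔪 if T = Assh M), one has Att H^1_𝔞(M) = T. -/
noncomputable section
open CategoryTheory

namespace Paper

section Secondary

variable {R : Type} [CommRing R] {M : Type} [AddCommGroup M] [Module R M]

lemma IsSecondaryFor.exists_pow_smul_eq {N : Submodule R M} {p : Ideal R}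
    (hN : IsSecondaryFor R N p) {r : R} (hr : r ∉ p) (n : ℕ) {m : M} (hm : m ∈ N) :
    ∃ m' ∈ N, r ^ n • m' = m := by
  obtain ⟨-, h, rfl⟩ := hN
  rcases h r with h | ⟨k, hk⟩
  · induction n generalizing m with
    | zero => exact ⟨m, hm, by simp⟩
    | succ n ih =>
      obtain ⟨m₁, hm₁, rfl⟩ := h m hm
      obtain ⟨m₂, hm₂, rfl⟩ := ih hm₁
      exact ⟨m₂, hm₂, by rw [pow_succ', mul_smul]⟩
  · exact absurd ⟨k, Submodule.mem_annihilator.2 hk⟩ hr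

lemma IsSecondaryFor.exists_pow_smul_eq_zero {N : Submodule R M} {p : Ideal R}
    (hN : IsSecondaryFor R N p) {r : R} (hr : r ∈ p) :
    ∃ n : ℕ, ∀ m ∈ N, r ^ n • m = 0 := by
  obtain ⟨-, -, rfl⟩ := hN
  obtain ⟨n, hn⟩ := hr
  exact ⟨n, Submodule.mem_annihilator.1 hn⟩

lemma MinSecRep.exists_submodule (rep : MinSecRep R M) (i : Fin rep.n) :
    ∃ K : Submodule R M, ∀ r : R, r ∈ rep.p i ↔ ∃ n : ℕ, ∀ m : M, r ^ n • m ∈ K := by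
  refine ⟨⨆ j ∈ ({i}ᶜ : Set (Fin rep.n)), rep.S j, fun r => ⟨fun hr => ?_, ?_⟩⟩
  · obtain ⟨n, hn⟩ := (rep.sec i).exists_pow_smul_eq_zero hr
    refine ⟨n, fun m => ?_⟩
    have hm : m ∈ rep.S i ⊔ ⨆ j ∈ ({i}ᶜ : Set (Fin rep.n)), rep.S j := by
      have : (⨆ j, rep.S j) ≤ rep.S i ⊔ ⨆ j ∈ ({i}ᶜ : Set (Fin rep.n)), rep.S j := by
        refine iSup_le fun j => ?_
        by_cases hj : j = i
        · subst hj
          exact le_sup_left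
        · exact le_sup_of_le_right
            (le_iSup₂_of_le (f := fun j (_ : j ∈ ({i}ᶜ : Set (Fin rep.n))) => rep.S j)
              j hj le_rfl)
      exact this (rep.sum ▸ Submodule.mem_top)
    obtain ⟨y, hy, z, hz, rfl⟩ := Submodule.mem_sup.1 hm
    rw [smul_add, hn y hy, zero_add]
    exact Submodule.smul_mem _ _ hz
  · rintro ⟨n, hn⟩
    by_contra hr
    refine rep.irred i fun m hm => ?_
    obtain ⟨m', -, rfl⟩ := (rep.sec i).exists_pow_smul_eq hr n hm
    exact hn m'

lemma MinSecRep.exists_eq_of_submodule (rep : MinSecRep R M) {p : Ideal R} [p.IsPrime]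
    {K : Submodule R M} (hp : ∀ r : R, r ∈ p ↔ ∃ n : ℕ, ∀ m : M, r ^ n • m ∈ K) :
    ∃ i, rep.p i = p := by
  classical
  let A : Finset (Fin rep.n) := Finset.univ.filter fun i => ¬ rep.S i ≤ K
  have hle : ∀ i ∈ A, p ≤ rep.p i := by
    intro i hi r hr
    by_contra hri
    obtain ⟨n, hn⟩ := (hp r).1 hr
    refine (Finset.mem_filter.1 hi).2 fun m hm => ?_
    obtain ⟨m', -, rfl⟩ := (rep.sec i).exists_pow_smul_eq hri n hm
    exact hn m'
  have hinf : A.inf rep.p ≤ p := by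
    intro r hr
    have h : ∀ i, ∃ n : ℕ, ∀ m ∈ rep.S i, r ^ n • m ∈ K := by
      intro i
      by_cases hi : rep.S i ≤ K
      · exact ⟨0, fun m hm => by simpa using hi hm⟩
      · have hri : r ∈ rep.p i :=
          Finset.inf_le (f := rep.p) (Finset.mem_filter.2 ⟨Finset.mem_univ i, hi⟩) hr
        obtain ⟨n, hn⟩ := (rep.sec i).exists_pow_smul_eq_zero hri
        exact ⟨n, fun m hm => by rw [hn m hm]; exact K.zero_mem⟩
    choose n hn using h
    refine (hp r).2 ⟨∑ i, n i, fun m => ?_⟩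
    have : (⨆ i, rep.S i) ≤ K.comap (r ^ (∑ i, n i) • LinearMap.id) := by
      refine iSup_le fun i m hm => ?_
      obtain ⟨d, hd⟩ := Nat.exists_eq_add_of_le
        (Finset.single_le_sum (f := n) (fun _ _ => Nat.zero_le _) (Finset.mem_univ i))
      simp only [Submodule.mem_comap, LinearMap.smul_apply, LinearMap.id_apply]
      rw [hd, add_comm, pow_add, mul_smul]
      exact K.smul_mem _ (hn i m hm)
    simpa using this (rep.sum ▸ Submodule.mem_top : m ∈ ⨆ i, rep.S i)
  obtain ⟨i, hi, hip⟩ := (Ideal.IsPrime.inf_le' ‹_›).1 hinf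
  exact ⟨i, le_antisymm hip (hle i hi)⟩

/-- The primes of a minimal secondary representation do not depend on the representation. -/
lemma attached_eq_range (rep : MinSecRep R M) : attached R M = Set.range rep.p := by
  ext q
  refine ⟨?_, fun ⟨i, hi⟩ => ⟨rep, i, hi⟩⟩
  rintro ⟨rep', i, rfl⟩
  obtain ⟨K, hK⟩ := rep'.exists_submodule i
  have := rep'.prime i
  exact rep.exists_eq_of_submodule hK

/-- If `J` kills `M`, `x` acts surjectively on `M`, the primes over `J` avoiding `x` lie in the
finite set `T` of pairwise incomparable primes, and each of these contains the annihilator of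
`M`, then `T` is the set of attached primes of `M`. -/
lemma attached_eq_of_surjective_smul [IsNoetherianRing R] {T : Set (Ideal R)} (hfin : T.Finite)
    (hprime : ∀ p ∈ T, p.IsPrime) (hanti : ∀ p ∈ T, ∀ q ∈ T, p ≤ q → p = q)
    {J : Ideal R} {x : R}
    (hJT : ∀ P : Ideal R, P.IsPrime → J ≤ P → x ∉ P → P ∈ T)
    (hJ : ∀ c ∈ J, ∀ m : M, c • m = 0) (hx : ∀ m : M, ∃ m' : M, x • m' = m)
    (hann : ∀ c : R, (∀ m : M, c • m = 0) → ∀ p ∈ T, c ∈ p) :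
    attached R M = T := by
  classical
  have hxn : ∀ (n : ℕ) (m : M), ∃ m' : M, x ^ n • m' = m := by
    intro n
    induction n with
    | zero => exact fun m => ⟨m, by simp⟩
    | succ n ih =>
      intro m
      obtain ⟨m₁, rfl⟩ := hx m
      obtain ⟨m₂, rfl⟩ := ih m₁
      exact ⟨m₂, by rw [pow_succ', mul_smul]⟩
  obtain ⟨n, p, hinj, rfl⟩ : ∃ (n : ℕ) (p : Fin n → Ideal R),
      Function.Injective p ∧ Set.range p = T := by
    have := hfin.to_subtype
    obtain ⟨n, ⟨e⟩⟩ := Finite.exists_equiv_fin T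
    refine ⟨n, fun i => (e.symm i : Ideal R),
      Subtype.val_injective.comp e.symm.injective, ?_⟩
    ext q
    exact ⟨fun ⟨i, hi⟩ => hi ▸ (e.symm i).2, fun hq => ⟨e ⟨q, hq⟩, by simp⟩⟩
  have hp : ∀ i, (p i).IsPrime := fun i => hprime _ ⟨i, rfl⟩
  have hpne : ∀ i j, p i ≤ p j → i = j := fun i j h => hinj (hanti _ ⟨i, rfl⟩ _ ⟨j, rfl⟩ h)
  obtain ⟨k, hk⟩ : ∃ k, ((∏ i, p i) * Ideal.span {x}) ^ k ≤ J := by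
    refine Ideal.exists_pow_le_of_le_radical_of_fg ?_ (IsNoetherian.noetherian _)
    rw [Ideal.radical_eq_sInf]
    refine le_sInf fun P ⟨hJP, hP⟩ => ?_
    by_cases hxP : x ∈ P
    · exact Ideal.mul_le_right.trans ((Ideal.span_singleton_le_iff_mem _).2 hxP)
    · obtain ⟨i, hi⟩ := hJT P hP hJP hxP
      refine Ideal.mul_le_left.trans ?_
      rw [← hi]
      exact (hp i).prod_le.2 ⟨i, Finset.mem_univ i, le_rfl⟩
  have hkill : ∀ c ∈ ∏ i, p i ^ k, ∀ m : M, c • m = 0 := by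
    intro c hc m
    obtain ⟨m', rfl⟩ := hxn k m
    rw [← mul_smul]
    refine hJ _ (hk ?_) m'
    rw [mul_pow, Ideal.span_singleton_pow, ← Finset.prod_pow]
    exact Ideal.mul_mem_mul hc (Ideal.mem_span_singleton_self _)
  let Q : Fin n → Ideal R := fun i => ∏ j ∈ Finset.univ.erase i, p j ^ k
  have hpQ : ∀ i, p i ^ k * Q i = ∏ j, p j ^ k := fun i =>
    Finset.mul_prod_erase _ (fun j => p j ^ k) (Finset.mem_univ i)
  let S : Fin n → Submodule R M := fun i => Q i • ⊤
  have hS0 : ∀ i, ∀ c ∈ p i ^ k, ∀ m ∈ S i, c • m = 0 := by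
    intro i c hc m hm
    refine Submodule.smul_induction_on hm (fun r hr y _ => ?_) fun y z hy hz => ?_
    · rw [← mul_smul]
      exact hkill _ (hpQ i ▸ Ideal.mul_mem_mul hc hr) y
    · rw [smul_add, hy, hz, add_zero]
  have hxS : ∀ (i : Fin n) (l : ℕ), ∀ m ∈ S i, ∃ m' ∈ S i, x ^ l • m' = m := by
    intro i l m hm
    refine Submodule.smul_induction_on hm (fun r hr y _ => ?_) ?_
    · obtain ⟨y', rfl⟩ := hxn l y
      exact ⟨r • y', Submodule.smul_mem_smul hr Submodule.mem_top, smul_comm _ _ _⟩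
    · rintro _ _ ⟨y, hy, rfl⟩ ⟨z, hz, rfl⟩
      exact ⟨y + z, add_mem hy hz, smul_add _ _ _⟩
  have hsum : (⨆ i, S i) = ⊤ := by
    have hrad : x ∈ ((⨆ i, Q i) ⊔ J).radical := by
      rw [Ideal.radical_eq_sInf, Submodule.mem_sInf]
      rintro P ⟨hle, hP⟩
      by_contra hxP
      obtain ⟨i, rfl⟩ := hJT P hP (le_sup_right.trans hle) hxP
      obtain ⟨j, hj, hji⟩ := (hp i).prod_le.1 ((le_iSup Q i).trans (le_sup_left.trans hle))
      exact (Finset.mem_erase.1 hj).1 (hpne j i ((hp i).le_of_pow_le hji))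
    obtain ⟨l, hl⟩ := hrad
    obtain ⟨s, hs, c, hc, hsc⟩ := Submodule.mem_sup.1 hl
    refine eq_top_iff.2 fun m _ => ?_
    obtain ⟨m', rfl⟩ := hxn l m
    rw [← hsc, add_smul, hJ c hc, add_zero, ← Submodule.iSup_smul]
    exact Submodule.smul_mem_smul hs Submodule.mem_top
  have hirr : ∀ i, ¬ (S i ≤ ⨆ j ∈ ({i}ᶜ : Set (Fin n)), S j) := by
    intro i hi
    have htop : (⨆ j ∈ ({i}ᶜ : Set (Fin n)), S j) = ⊤ := by
      refine eq_top_iff.2 (hsum ▸ iSup_le fun j => ?_)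
      by_cases hj : j = i
      · exact hj ▸ hi
      · exact le_iSup₂_of_le (f := fun j (_ : j ∈ ({i}ᶜ : Set (Fin n))) => S j) j hj le_rfl
    have hQi : Q i ≤ p i := by
      intro c hc
      refine hann c (fun m => ?_) _ ⟨i, rfl⟩
      have : (⨆ j ∈ ({i}ᶜ : Set (Fin n)), S j) ≤ LinearMap.ker (c • LinearMap.id) := by
        refine iSup₂_le fun j hj y hy => ?_
        refine hS0 j c ?_ y hy
        exact Ideal.le_of_dvd (Finset.dvd_prod_of_mem _
          (Finset.mem_erase.2 ⟨hj, Finset.mem_univ j⟩)) hc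
      simpa using this (htop ▸ Submodule.mem_top : m ∈ _)
    obtain ⟨j, hj, hji⟩ := (hp i).prod_le.1 hQi
    exact (Finset.mem_erase.1 hj).1 (hpne j i ((hp i).le_of_pow_le hji))
  have hne : ∀ i, S i ≠ ⊥ := fun i h => hirr i (h ▸ bot_le)
  have hsurj : ∀ i, ∀ r ∉ p i, ∀ m ∈ S i, ∃ m' ∈ S i, r • m' = m := by
    intro i r hr m hm
    have hrad : x ∈ (Ideal.span {r} ⊔ p i ^ k ⊔ J).radical := by
      rw [Ideal.radical_eq_sInf, Submodule.mem_sInf]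
      rintro P ⟨hle, hP⟩
      by_contra hxP
      obtain ⟨j, rfl⟩ := hJT P hP (le_sup_right.trans hle) hxP
      obtain rfl := hpne i j
        ((hp j).le_of_pow_le ((le_sup_right.trans le_sup_left).trans hle))
      exact hr ((le_sup_left.trans le_sup_left).trans hle (Ideal.mem_span_singleton_self r))
    obtain ⟨l, hl⟩ := hrad
    obtain ⟨s, hs, c, hc, hsc⟩ := Submodule.mem_sup.1 hl
    obtain ⟨t, ht, d, hd, rfl⟩ := Submodule.mem_sup.1 hs
    obtain ⟨u, rfl⟩ := Ideal.mem_span_singleton'.1 ht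
    obtain ⟨m', hm', rfl⟩ := hxS i l m hm
    refine ⟨u • m', Submodule.smul_mem _ _ hm', ?_⟩
    rw [← hsc, add_smul, add_smul, hJ c hc, hS0 i d hd m' hm', add_zero, add_zero, mul_comm,
      mul_smul]
  have hnil : ∀ i, ∀ r ∈ p i, ∀ m ∈ S i, r ^ k • m = 0 := fun i r hr =>
    hS0 i _ (Ideal.pow_mem_pow hr k)
  have hrad : ∀ i, (S i).annihilator.radical = p i := by
    intro i
    refine le_antisymm (fun r hr => ?_) fun r hr =>
      ⟨k, Submodule.mem_annihilator.2 (hnil i r hr)⟩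
    by_contra hri
    obtain ⟨l, hl⟩ := hr
    refine hne i ((Submodule.eq_bot_iff _).2 fun m hm => ?_)
    obtain ⟨m', hm', rfl⟩ := hsurj i (r ^ l) (fun h => hri ((hp i).mem_of_pow_mem l h)) m hm
    exact Submodule.mem_annihilator.1 hl m' hm'
  exact attached_eq_range
    { n := n, S := S, p := p, prime := hp, sum := hsum, inj := hinj, irred := hirr
      sec := fun i => ⟨hne i, fun r => by
        by_cases hr : r ∈ p i
        · exact Or.inr ⟨k, hnil i r hr⟩
        · exact Or.inl (hsurj i r hr), hrad i⟩ }

end Secondary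

section IdealTransform

variable {R : Type} [CommRing R] {M : Type} [AddCommGroup M] [Module R M]

/-- On an ideal contained in `(x) + Ann M`, division by `x` followed by multiplication by `y`
is a well-defined linear map, as soon as it is single-valued. -/
lemma exists_linearMap_of_le_span_sup {I : Ideal R} {x : R} {y : M}
    (hI : I ≤ Ideal.span {x} ⊔ Module.annihilator R M)
    (hy : ∀ r : R, r * x ∈ Module.annihilator R M → r • y = 0) :
    ∃ g : I →ₗ[R] M, ∀ (u : I) (r : R),
      (u : R) - r * x ∈ Module.annihilator R M → g u = r • y := by
  have hex : ∀ u : I, ∃ r : R, (u : R) - r * x ∈ Module.annihilator R M := by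
    intro u
    obtain ⟨s, hs, c, hc, h⟩ := Submodule.mem_sup.1 (hI u.2)
    obtain ⟨r, rfl⟩ := Ideal.mem_span_singleton'.1 hs
    exact ⟨r, by rw [← h, add_sub_cancel_left]; exact hc⟩
  have huniq : ∀ (u : R) (r s : R), u - r * x ∈ Module.annihilator R M →
      u - s * x ∈ Module.annihilator R M → r • y = s • y := by
    intro u r s hr hs
    rw [← sub_eq_zero, ← sub_smul]
    refine hy _ ?_
    have := sub_mem hs hr
    rwa [sub_sub_sub_cancel_left, ← sub_mul] at this
  choose q hq using hex
  refine ⟨{ toFun := fun u => q u • y, map_add' := fun u v => ?_, map_smul' := fun a u => ?_ },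
    fun u r hr => huniq u _ _ (hq u) hr⟩
  · rw [← add_smul]
    refine huniq _ _ _ (hq (u + v)) ?_
    have := add_mem (hq u) (hq v)
    rwa [sub_add_sub_comm, ← add_mul] at this
  · rw [RingHom.id_apply, ← mul_smul]
    refine huniq _ _ _ (hq (a • u)) ?_
    have := Ideal.mul_mem_left _ a (hq u)
    rwa [mul_sub, ← mul_assoc] at this

lemma exists_pow_smul_eq_zero_stable [IsNoetherian R M] (x : R) :
    ∃ K : ℕ, ∀ (n : ℕ) (m : M), x ^ n • m = 0 → x ^ K • m = 0 := by
  have hmem : ∀ (n : ℕ) (m : M),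
      m ∈ (LinearMap.lsmul R M x).iterateKer n ↔ x ^ n • m = 0 := by
    intro n m
    have : ((LinearMap.lsmul R M x) ^ n) m = x ^ n • m := by
      induction n with
      | zero => simp
      | succ n ih => rw [pow_succ', Module.End.mul_apply, ih, pow_succ', mul_smul]; rfl
    rw [← this]; rfl
  obtain ⟨K, hK⟩ := monotone_stabilizes_iff_noetherian.2 ‹IsNoetherian R M›
    (LinearMap.lsmul R M x).iterateKer
  refine ⟨K, fun n m h => ?_⟩
  rw [← hmem] at h ⊢
  rcases le_total K n with hn | hn
  · rw [hK n hn]; exact h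
  · exact (LinearMap.lsmul R M x).iterateKer.monotone hn h

lemma linearMap_eq_zero_of_mem_mul_annihilator {I : Ideal R} (f : I →ₗ[R] M) {c : R}
    (hc : c ∈ I * Module.annihilator R M) : f ⟨c, Ideal.mul_le_left hc⟩ = 0 := by
  have : I * Module.annihilator R M ≤ (LinearMap.ker f).map I.subtype := by
    refine Ideal.mul_le.2 fun r hr s hs => ?_
    refine ⟨s • ⟨r, hr⟩, ?_, mul_comm s r⟩
    rw [SetLike.mem_coe, LinearMap.mem_ker, map_smul]
    exact Module.mem_annihilator.1 hs _
  obtain ⟨u, hu, rfl⟩ := this hc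
  exact hu

variable {a : Ideal R} {x : R} {H : Type} [AddCommGroup H] [Module R H]
  (δ : ∀ n : ℕ, (↥(a ^ n) →ₗ[R] M) →ₗ[R] H)

include δ in
lemma smul_eq_zero_of_mem_annihilator (hsurj : ∀ h, ∃ n f, δ n f = h) {c : R}
    (hc : c ∈ Module.annihilator R M) (h : H) : c • h = 0 := by
  obtain ⟨n, f, rfl⟩ := hsurj h
  rw [← map_smul]
  convert map_zero (δ n)
  ext u
  exact Module.mem_annihilator.1 hc _

variable [IsNoetherianRing R] [Module.Finite R M]

include δ in
lemma exists_smul_eq_of_mem (hsurj : ∀ h, ∃ n f, δ n f = h)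
    (hcompat : ∀ (n N : ℕ) (h : n ≤ N) (f : ↥(a ^ n) →ₗ[R] M),
      δ N (f ∘ₗ Submodule.inclusion (Ideal.pow_le_pow_right h)) = δ n f)
    (hxa : x ∈ a) (hax : ∀ n : ℕ, ∃ N : ℕ, a ^ N ≤ Ideal.span {x ^ n} ⊔ Module.annihilator R M)
    (h : H) : ∃ h', x • h' = h := by
  obtain ⟨n, f, rfl⟩ := hsurj h
  obtain ⟨K, hK⟩ := exists_pow_smul_eq_zero_stable (M := M) x
  obtain ⟨k, hk⟩ := a.exists_pow_inf_eq_pow_smul (Module.annihilator R M : Submodule R R)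
  have hAR : a ^ (n + k) ⊓ Module.annihilator R M ≤ a ^ n * Module.annihilator R M := by
    have := hk (n + k) (Nat.le_add_left k n)
    rw [Nat.add_sub_cancel, smul_eq_mul, Ideal.mul_top] at this
    rw [this]
    exact Ideal.mul_mono_right inf_le_right
  obtain ⟨N₀, hN₀⟩ := hax (n + k + K + 1)
  have hxn : x ^ n ∈ a ^ n := Ideal.pow_mem_pow hxa n
  set w : M := f ⟨x ^ n, hxn⟩ with hw
  have hN : a ^ (N₀ + (n + k)) ≤ Ideal.span {x ^ (n + k + K + 1)} ⊔ Module.annihilator R M :=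
    (Ideal.pow_le_pow_right (Nat.le_add_right _ _)).trans hN₀
  obtain ⟨g, hg⟩ := exists_linearMap_of_le_span_sup (y := x ^ (k + K) • w) hN (by
    intro r hr
    have h1 := hK (n + k + K + 1) (r • w) (by
      rw [← mul_smul, mul_comm]; exact Module.mem_annihilator.1 hr w)
    rw [pow_add, mul_smul, smul_comm r, smul_comm r, h1, smul_zero])
  have hle : n ≤ N₀ + (n + k) := by omega
  refine ⟨δ _ g, ?_⟩
  rw [← map_smul, ← hcompat n _ hle f]
  congr 1
  ext u
  obtain ⟨s, hs, c, hc, hsc⟩ := Submodule.mem_sup.1 (hN u.2)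
  obtain ⟨r, rfl⟩ := Ideal.mem_span_singleton'.1 hs
  have huc : (u : R) - r * x ^ (n + k + K + 1) = c := by rw [← hsc, add_sub_cancel_left]
  have hca : c ∈ a ^ (n + k) := by
    rw [← huc]
    refine sub_mem (Ideal.pow_le_pow_right (by omega) u.2) (Ideal.mul_mem_left _ _ ?_)
    exact Ideal.pow_le_pow_right (by omega) (Ideal.pow_mem_pow hxa _)
  have hfc := linearMap_eq_zero_of_mem_mul_annihilator f (hAR ⟨hca, hc⟩)
  rw [LinearMap.smul_apply, hg u r (huc ▸ hc), LinearMap.comp_apply]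
  have hu : Submodule.inclusion (Ideal.pow_le_pow_right hle) u =
      (r * x ^ (k + K + 1)) • (⟨x ^ n, hxn⟩ : ↥(a ^ n)) +
        ⟨c, Ideal.mul_le_left (hAR ⟨hca, hc⟩)⟩ := by
    ext
    simp only [Submodule.coe_inclusion, Submodule.coe_add, Submodule.coe_smul, smul_eq_mul]
    rw [← hsc]
    ring
  rw [hu, map_add, hfc, add_zero, map_smul, ← hw, ← mul_smul, ← mul_smul]
  congr 1
  ring

include δ in
lemma mem_of_forall_smul_eq_zero
    (hker : ∀ (n : ℕ) (f : ↥(a ^ n) →ₗ[R] M), δ n f = 0 → ∃ (N : ℕ) (m : M),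
      ∀ u : ↥(a ^ n), (u : R) ∈ a ^ N → f u = (u : R) • m)
    (hxa : x ∈ a) (hax : ∀ n : ℕ, ∃ N : ℕ, a ^ N ≤ Ideal.span {x ^ n} ⊔ Module.annihilator R M)
    (hxj : x ∈ Ideal.jacobson (⊥ : Ideal R)) {c : R} (hc : ∀ h : H, c • h = 0)
    {q : Ideal R} [q.IsPrime] (hq : Module.annihilator R M ≤ q) (hxq : x ∉ q) : c ∈ q := by
  obtain ⟨K, hK⟩ := exists_pow_smul_eq_zero_stable (M := M) x
  have key : ∀ (m : M) (k : ℕ), ∃ m' : M, x ^ K • c • m = x ^ k • m' := by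
    intro m k
    obtain ⟨N, hN⟩ := hax (K + k)
    obtain ⟨g, hg⟩ := exists_linearMap_of_le_span_sup (y := x ^ K • m) hN (by
      intro r hr
      rw [smul_comm]
      refine hK (K + k) (r • m) ?_
      rw [← mul_smul, mul_comm]; exact Module.mem_annihilator.1 hr m)
    obtain ⟨N', m', hm'⟩ := hker N (c • g) (by rw [map_smul, hc])
    have hmem : ∀ l, l ≤ K + k + (N + N') → x ^ (K + k + (N + N')) ∈ a ^ l := fun l hl =>
      Ideal.pow_le_pow_right hl (Ideal.pow_mem_pow hxa _)
    have h1 := hm' ⟨_, hmem N (by omega)⟩ (hmem N' (by omega))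
    rw [LinearMap.smul_apply, hg _ (x ^ (N + N')) (by
      convert zero_mem (Module.annihilator R M) using 1
      ring)] at h1
    have h2 := hK (K + (N + N')) (c • m - x ^ k • m') (by
      rw [smul_sub, sub_eq_zero]
      convert h1 using 1
      · rw [← mul_smul, ← mul_smul, ← mul_smul]; congr 1; ring
      · rw [← mul_smul]; congr 1; ring)
    refine ⟨x ^ K • m', ?_⟩
    rw [smul_comm (x ^ k), ← sub_eq_zero, ← smul_sub]
    exact h2
  have hzero : x ^ K * c ∈ Module.annihilator R M := by
    refine Module.mem_annihilator.2 fun m => ?_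
    have hbot := Ideal.iInf_pow_smul_eq_bot_of_le_jacobson (M := M) (Ideal.span {x})
      ((Ideal.span_singleton_le_iff_mem _).2 hxj)
    rw [← Submodule.mem_bot R, ← hbot, Submodule.mem_iInf]
    intro k
    obtain ⟨m', hm'⟩ := key m k
    rw [mul_smul, hm']
    exact Submodule.smul_mem_smul (Ideal.pow_mem_pow (Ideal.mem_span_singleton_self x) k)
      Submodule.mem_top
  exact (Ideal.IsPrime.mem_or_mem ‹_› (hq hzero)).resolve_left
    fun h => hxq (Ideal.IsPrime.mem_of_pow_mem ‹_› _ h)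

end IdealTransform

section ExtOne

open Opposite Limits

variable {R : Type} [CommRing R]

section

variable {X : ModuleCat.{0} R} (P : ProjectiveResolution X) (Y : ModuleCat.{0} R)

/-- The complex `Hom(P, Y)`, seen in the opposite category. -/
abbrev homComplex : ChainComplex (ModuleCat.{0} R)ᵒᵖ ℕ :=
  (((linearYoneda R (ModuleCat.{0} R)).obj Y).rightOp.mapHomologicalComplex _).obj P.complex

/-- The inclusion of the `1`-cocycles of `Hom(P, Y)`. -/
def cocycleι : ((homComplex P Y).opcycles 1).unop →ₗ[R] (P.complex.X 1 ⟶ Y) :=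
  ((homComplex P Y).pOpcycles 1).unop.hom

lemma cocycleι_injective : Function.Injective (cocycleι P Y) :=
  (ModuleCat.mono_iff_injective ((homComplex P Y).pOpcycles 1).unop).1 inferInstance

lemma mem_range_cocycleι (φ : P.complex.X 1 ⟶ Y) :
    φ ∈ LinearMap.range (cocycleι P Y) ↔ P.complex.d 2 1 ≫ φ = 0 := by
  have h := ShortComplex.exact_of_g_is_cokernel
    (.mk _ _ ((homComplex P Y).d_pOpcycles 2 1))
    ((homComplex P Y).opcyclesIsCokernel 2 1 (by simp))
  have hex := (ShortComplex.moduleCat_exact_iff_range_eq_ker _).1 h.unop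
  exact SetLike.ext_iff.1 hex φ

/-- The first derived functor of `Hom(-, Y)` as the homology of `Hom(P, Y)`. -/
def derivedIso : (((linearYoneda R (ModuleCat.{0} R)).obj Y).rightOp.leftDerived 1).obj X ≅
    (homComplex P Y).homology 1 :=
  P.isoLeftDerivedObj _ 1

/-- The map from `1`-cocycles to `Ext¹`. -/
def cocycleClass : ((homComplex P Y).opcycles 1).unop →ₗ[R]
    ((Ext R (ModuleCat.{0} R) 1).obj (op X)).obj Y :=
  ((derivedIso P Y).hom ≫ (homComplex P Y).homologyι 1).unop.hom

lemma cocycleClass_surjective : Function.Surjective (cocycleClass P Y) := by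
  have : Mono ((derivedIso P Y).hom ≫ (homComplex P Y).homologyι 1) := mono_comp _ _
  exact (ModuleCat.epi_iff_surjective _).1 (unop_epi_of_mono
    ((derivedIso P Y).hom ≫ (homComplex P Y).homologyι 1))

lemma cocycleι_fromOpcycles (ψ : P.complex.X 0 ⟶ Y) :
    cocycleι P Y (((homComplex P Y).fromOpcycles 1 0).unop.hom ψ) = P.complex.d 1 0 ≫ ψ :=
  congrArg (fun g => g.unop.hom ψ) ((homComplex P Y).p_fromOpcycles 1 0)

lemma cocycleClass_eq_zero_iff (z : ((homComplex P Y).opcycles 1).unop) :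
    cocycleClass P Y z = 0 ↔ ∃ ψ : P.complex.X 0 ⟶ Y, P.complex.d 1 0 ≫ ψ = cocycleι P Y z := by
  have h := ShortComplex.exact_of_f_is_kernel
    (.mk _ _ ((homComplex P Y).homologyι_comp_fromOpcycles 1 0))
    ((homComplex P Y).homologyIsKernel 1 0 (by simp))
  have h' := SetLike.ext_iff.1 ((ShortComplex.moduleCat_exact_iff_range_eq_ker _).1 h.unop) z
  have h0 : cocycleClass P Y z = 0 ↔ ((homComplex P Y).homologyι 1).unop.hom z = 0 := by
    let e := (derivedIso P Y).unop.toLinearEquiv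
    exact e.map_eq_zero_iff (x := ((homComplex P Y).homologyι 1).unop.hom z)
  rw [h0]
  refine Iff.trans h'.symm (exists_congr fun ψ => ?_)
  exact (cocycleι_injective P Y).eq_iff.symm.trans (Eq.congr_left (cocycleι_fromOpcycles P Y ψ))

end

lemma exists_map_cocycleClass {X X' : ModuleCat.{0} R} (P : ProjectiveResolution X)
    (P' : ProjectiveResolution X') (Y : ModuleCat.{0} R) (f : X' ⟶ X)
    (φ : P'.complex ⟶ P.complex) (hφ : φ.f 0 ≫ P.π.f 0 = P'.π.f 0 ≫ f)
    (z : ((homComplex P Y).opcycles 1).unop) :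
    ∃ z', cocycleι P' Y z' = φ.f 1 ≫ cocycleι P Y z ∧
      (((Ext R (ModuleCat.{0} R) 1).map f.op).app Y).hom (cocycleClass P Y z) =
        cocycleClass P' Y z' := by
  let F := ((linearYoneda R (ModuleCat.{0} R)).obj Y).rightOp
  let Φ : homComplex P' Y ⟶ homComplex P Y := (F.mapHomologicalComplex _).map φ
  refine ⟨(HomologicalComplex.opcyclesMap Φ 1).unop.hom z, ?_, ?_⟩
  · exact congrArg (fun g => g.unop.hom z) (HomologicalComplex.p_opcyclesMap Φ 1)
  · have h : (F.leftDerived 1).map f ≫ (derivedIso P Y).hom =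
        (derivedIso P' Y).hom ≫ HomologicalComplex.homologyMap Φ 1 :=
      ProjectiveResolution.isoLeftDerivedObj_hom_naturality f P' P φ hφ F 1
    have h' : (F.leftDerived 1).map f ≫ (derivedIso P Y).hom ≫ (homComplex P Y).homologyι 1 =
        ((derivedIso P' Y).hom ≫ (homComplex P' Y).homologyι 1) ≫
          HomologicalComplex.opcyclesMap Φ 1 := by
      rw [reassoc_of% h, HomologicalComplex.homologyι_naturality, Category.assoc]
    exact congrArg (fun g => g.unop.hom z) h'

section Resolution

variable {I : Ideal R} (P : ProjectiveResolution (ModuleCat.of R (R ⧸ I)))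

/-- The augmentation of a projective resolution of `R ⧸ I`. -/
def augmentation : P.complex.X 0 →ₗ[R] R ⧸ I := (P.π.f 0).hom

lemma augmentation_surjective : Function.Surjective (augmentation P) :=
  (ModuleCat.epi_iff_surjective (P.π.f 0)).1 inferInstance

lemma range_d_eq_ker_augmentation :
    LinearMap.range (P.complex.d 1 0).hom = LinearMap.ker (augmentation P) :=
  (ShortComplex.moduleCat_exact_iff_range_eq_ker _).1 P.exact₀

lemma range_d_eq_ker_d :
    LinearMap.range (P.complex.d 2 1).hom = LinearMap.ker (P.complex.d 1 0).hom :=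
  (ShortComplex.moduleCat_exact_iff_range_eq_ker _).1 (P.exact_succ 0)

lemma exists_augmentationLift :
    ∃ σ : P.complex.X 0 →ₗ[R] R, I.mkQ ∘ₗ σ = augmentation P := by
  have : Module.Projective R (P.complex.X 0) :=
    (IsProjective.iff_projective _).2 (P.projective 0)
  exact Module.projective_lifting_property _ _ (Submodule.mkQ_surjective I)

/-- A lift of the augmentation of a projective resolution of `R ⧸ I` to `R`. -/
def augmentationLift : P.complex.X 0 →ₗ[R] R := (exists_augmentationLift P).choose

lemma mk_augmentationLift (w : P.complex.X 0) :
    Submodule.Quotient.mk (augmentationLift P w) = augmentation P w :=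
  LinearMap.congr_fun (exists_augmentationLift P).choose_spec w

lemma augmentation_d (w : P.complex.X 1) : augmentation P ((P.complex.d 1 0).hom w) = 0 := by
  rw [← LinearMap.mem_ker, ← range_d_eq_ker_augmentation]
  exact ⟨w, rfl⟩

/-- The map from the first syzygies of `R ⧸ I` to `I`. -/
def toIdeal : P.complex.X 1 →ₗ[R] I :=
  (augmentationLift P ∘ₗ (P.complex.d 1 0).hom).codRestrict I fun w => by
    rw [← Submodule.Quotient.mk_eq_zero, LinearMap.comp_apply, mk_augmentationLift,
      augmentation_d]

lemma coe_toIdeal (w : P.complex.X 1) :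
    (toIdeal P w : R) = augmentationLift P ((P.complex.d 1 0).hom w) := rfl

lemma toIdeal_d (w : P.complex.X 2) : toIdeal P ((P.complex.d 2 1).hom w) = 0 := by
  have h : (P.complex.d 1 0).hom ((P.complex.d 2 1).hom w) = 0 := by
    rw [← LinearMap.mem_ker, ← range_d_eq_ker_d]
    exact ⟨w, rfl⟩
  ext
  rw [coe_toIdeal, h, map_zero]
  rfl

variable (Y : ModuleCat.{0} R)

/-- Precomposition with `toIdeal`, as a map from `Hom(I, Y)` to `1`-cocycles. -/
def toCocycles : (I →ₗ[R] Y) →ₗ[R] ((homComplex P Y).opcycles 1).unop :=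
  (LinearEquiv.ofInjective (cocycleι P Y) (cocycleι_injective P Y)).symm.toLinearMap ∘ₗ
    LinearMap.codRestrict (LinearMap.range (cocycleι P Y))
      { toFun := fun f => ModuleCat.ofHom (f ∘ₗ toIdeal P)
        map_add' := fun _ _ => rfl
        map_smul' := fun _ _ => rfl }
      fun f => (mem_range_cocycleι P Y _).2 (by
        ext w
        exact (congrArg f (toIdeal_d P w)).trans (map_zero f))

lemma cocycleι_toCocycles (f : I →ₗ[R] Y) :
    cocycleι P Y (toCocycles P Y f) = ModuleCat.ofHom (f ∘ₗ toIdeal P) :=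
  congrArg Subtype.val
    ((LinearEquiv.ofInjective (cocycleι P Y) (cocycleι_injective P Y)).apply_symm_apply _)

/-- The connecting map `Hom(I, Y) → Ext¹(R ⧸ I, Y)`. -/
def extOneMap : (I →ₗ[R] Y) →ₗ[R]
    ((Ext R (ModuleCat.{0} R) 1).obj (op (ModuleCat.of R (R ⧸ I)))).obj Y :=
  cocycleClass P Y ∘ₗ toCocycles P Y

lemma exists_augmentation_eq_mk_one :
    ∃ e : P.complex.X 0, augmentation P e = Submodule.Quotient.mk 1 :=
  augmentation_surjective P _

lemma smul_mem_range_d {e : P.complex.X 0} (he : augmentation P e = Submodule.Quotient.mk 1)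
    (u : I) : (u : R) • e ∈ LinearMap.range (P.complex.d 1 0).hom := by
  rw [range_d_eq_ker_augmentation, LinearMap.mem_ker, map_smul, he,
    ← Submodule.Quotient.mk_smul, Submodule.Quotient.mk_eq_zero, smul_eq_mul, mul_one]
  exact u.2

lemma extOneMap_surjective : Function.Surjective (extOneMap P Y) := by
  intro h
  obtain ⟨z, rfl⟩ := cocycleClass_surjective P Y h
  obtain ⟨e, he⟩ := exists_augmentation_eq_mk_one P
  let d := (P.complex.d 1 0).hom
  let φ : P.complex.X 1 →ₗ[R] Y := (cocycleι P Y z).hom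
  have hφ : LinearMap.ker d ≤ LinearMap.ker φ := by
    rw [← range_d_eq_ker_d]
    rintro _ ⟨w, rfl⟩
    exact congrArg (fun g => g.hom w) ((mem_range_cocycleι P Y _).1 ⟨z, rfl⟩)
  let φ' : LinearMap.range d →ₗ[R] Y :=
    (LinearMap.ker d).liftQ φ hφ ∘ₗ d.quotKerEquivRange.symm.toLinearMap
  have hφ' : ∀ w, φ' ⟨d w, w, rfl⟩ = φ w := by
    intro w
    have : d.quotKerEquivRange.symm ⟨d w, w, rfl⟩ = Submodule.Quotient.mk w :=
      d.quotKerEquivRange.symm_apply_eq.2 rfl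
    change (LinearMap.ker d).liftQ φ hφ (d.quotKerEquivRange.symm ⟨d w, w, rfl⟩) = φ w
    rw [this]
    rfl
  let f : I →ₗ[R] Y := φ' ∘ₗ
    (LinearMap.toSpanSingleton R _ e ∘ₗ I.subtype).codRestrict _ (smul_mem_range_d P he)
  let ψ : P.complex.X 0 →ₗ[R] Y := φ' ∘ₗ
    (LinearMap.id - LinearMap.toSpanSingleton R _ e ∘ₗ augmentationLift P).codRestrict _
      fun w => by
        rw [range_d_eq_ker_augmentation, LinearMap.mem_ker]
        rw [LinearMap.sub_apply, LinearMap.id_apply, LinearMap.comp_apply,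
          LinearMap.toSpanSingleton_apply, map_sub, map_smul, he, ← mk_augmentationLift,
          ← Submodule.Quotient.mk_smul, smul_eq_mul, mul_one, sub_self]
  refine ⟨f, ?_⟩
  rw [eq_comm, ← sub_eq_zero, extOneMap, LinearMap.comp_apply, ← map_sub,
    cocycleClass_eq_zero_iff]
  refine ⟨ModuleCat.ofHom ψ, ?_⟩
  rw [map_sub, cocycleι_toCocycles]
  ext w
  change φ' _ = φ w - φ' _
  rw [← hφ', ← map_sub]
  rfl

lemma exists_eq_smul_of_extOneMap_eq_zero {f : I →ₗ[R] Y} (hf : extOneMap P Y f = 0) :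
    ∃ m : Y, ∀ u : I, f u = (u : R) • m := by
  obtain ⟨ψ, hψ⟩ := (cocycleClass_eq_zero_iff P Y _).1 hf
  rw [cocycleι_toCocycles] at hψ
  obtain ⟨e, he⟩ := exists_augmentation_eq_mk_one P
  have hσ : augmentationLift P e - 1 ∈ I := by
    rw [← Submodule.Quotient.eq, mk_augmentationLift, he]
  refine ⟨ψ.hom e - f ⟨_, hσ⟩, fun u => ?_⟩
  obtain ⟨w, hw⟩ := smul_mem_range_d P he u
  have h : ψ.hom ((P.complex.d 1 0).hom w) = f (toIdeal P w) :=
    congrArg (fun g => g.hom w) hψ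
  have hu : toIdeal P w = u + (u : R) • ⟨_, hσ⟩ := by
    ext
    rw [coe_toIdeal, hw, map_smul]
    simp only [Submodule.coe_add, Submodule.coe_smul, smul_eq_mul]
    ring
  rw [hw, hu, map_add, map_smul, map_smul] at h
  rw [smul_sub, h, add_sub_cancel_right]

variable {I' : Ideal R} (P' : ProjectiveResolution (ModuleCat.of R (R ⧸ I')))

lemma map_extOneMap (hle : I' ≤ I) (f : I →ₗ[R] Y) :
    (((Ext R (ModuleCat.{0} R) 1).map
      (ModuleCat.ofHom (Submodule.mapQ I' I LinearMap.id hle)).op).app Y).hom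
        (extOneMap P Y f) = extOneMap P' Y (f ∘ₗ Submodule.inclusion hle) := by
  let q : ModuleCat.of R (R ⧸ I') ⟶ ModuleCat.of R (R ⧸ I) :=
    ModuleCat.ofHom (Submodule.mapQ I' I LinearMap.id hle)
  let φ := ProjectiveResolution.lift q P' P
  have hφ : φ.f 0 ≫ P.π.f 0 = P'.π.f 0 ≫ q := ProjectiveResolution.lift_commutes_zero q P' P
  obtain ⟨z, hz, hz'⟩ := exists_map_cocycleClass P P' Y q φ hφ (toCocycles P Y f)
  refine hz'.trans ?_
  rw [← sub_eq_zero, extOneMap, LinearMap.comp_apply, ← map_sub, cocycleClass_eq_zero_iff]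
  let β : P'.complex.X 0 →ₗ[R] I :=
    (augmentationLift P ∘ₗ (φ.f 0).hom - augmentationLift P').codRestrict I fun w => by
      have h : augmentation P ((φ.f 0).hom w) =
          Submodule.mapQ I' I LinearMap.id hle (augmentation P' w) :=
        congrArg (fun g => g.hom w) hφ
      rw [LinearMap.sub_apply, LinearMap.comp_apply, ← Submodule.Quotient.eq,
        mk_augmentationLift, h, ← mk_augmentationLift]
      rfl
  refine ⟨ModuleCat.ofHom (f ∘ₗ β), ?_⟩
  rw [map_sub, hz, cocycleι_toCocycles, cocycleι_toCocycles]
  ext w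
  change f _ = f _ - f _
  rw [← map_sub]
  congr 1
  ext
  have hcomm : (φ.f 0).hom ((P'.complex.d 1 0).hom w) = (P.complex.d 1 0).hom ((φ.f 1).hom w) :=
    congrArg (fun g => g.hom w) (φ.comm 1 0).symm
  change augmentationLift P ((φ.f 0).hom ((P'.complex.d 1 0).hom w)) - _ =
    augmentationLift P ((P.complex.d 1 0).hom ((φ.f 1).hom w)) - _
  rw [hcomm]
  rfl

end Resolution

end ExtOne

section Colimit

open Opposite Limits

variable {R : Type} [CommRing R] (a : Ideal R) (M : Type) [AddCommGroup M] [Module R M]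

/-- The natural map from `Hom(aⁿ, M)` to `H¹_a(M)`. -/
lemma exists_linearMap_H_one : ∃ δ : ∀ n : ℕ, (↥(a ^ n) →ₗ[R] M) →ₗ[R] H R a 1 M,
    (∀ h, ∃ n f, δ n f = h) ∧
    (∀ (n N : ℕ) (h : n ≤ N) (f : ↥(a ^ n) →ₗ[R] M),
      δ N (f ∘ₗ Submodule.inclusion (Ideal.pow_le_pow_right h)) = δ n f) ∧
    (∀ (n : ℕ) (f : ↥(a ^ n) →ₗ[R] M), δ n f = 0 → ∃ (N : ℕ) (m : M),
      ∀ u : ↥(a ^ n), (u : R) ∈ a ^ N → f u = (u : R) • m) := by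
  let Y := ModuleCat.of R M
  let D := localCohomology.diagram (localCohomology.idealPowersDiagram a) 1
  let ev := (evaluation (ModuleCat.{0} R) (ModuleCat.{0} R)).obj Y
  let hcol : IsColimit (ev.mapCocone (colimit.cocone D)) :=
    isColimitOfPreserves ev (colimit.isColimit D)
  let P : ∀ n : ℕ, ProjectiveResolution (ModuleCat.of R (R ⧸ a ^ n)) :=
    fun n => projectiveResolution _
  let δ : ∀ n : ℕ, (↥(a ^ n) →ₗ[R] M) →ₗ[R] H R a 1 M := fun n =>
    ((ev.mapCocone (colimit.cocone D)).ι.app (op (op n))).hom ∘ₗ extOneMap (P n) Y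
  have hmap : ∀ (n N : ℕ) (h : n ≤ N) (f : ↥(a ^ n) →ₗ[R] M),
      ((D ⋙ ev).map (homOfLE h).op.op).hom (extOneMap (P n) Y f) =
        extOneMap (P N) Y (f ∘ₗ Submodule.inclusion (Ideal.pow_le_pow_right h)) :=
    fun n N h f => map_extOneMap (P n) Y (P N) (Ideal.pow_le_pow_right h) f
  refine ⟨δ, fun h => ?_, fun n N h f => ?_, fun n f hf => ?_⟩
  · obtain ⟨j, y, hy⟩ := Concrete.isColimit_exists_rep (D ⋙ ev) hcol h
    obtain ⟨f, rfl⟩ := extOneMap_surjective (P j.unop.unop) Y y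
    exact ⟨j.unop.unop, f, hy⟩
  · have := congrArg (fun g => g.hom (extOneMap (P n) Y f))
      ((ev.mapCocone (colimit.cocone D)).w (homOfLE h).op.op)
    refine Eq.trans ?_ this
    exact congrArg _ (hmap n N h f).symm
  · have h0 : δ n f = ((ev.mapCocone (colimit.cocone D)).ι.app (op (op n))).hom 0 :=
      hf.trans (map_zero _).symm
    obtain ⟨k, i, j, hij⟩ := Concrete.isColimit_exists_of_rep_eq (D ⋙ ev) hcol _ _ h0
    have hle : n ≤ k.unop.unop := leOfHom i.unop.unop
    have hi : i = (homOfLE hle).op.op := Subsingleton.elim _ _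
    have hz : extOneMap (P k.unop.unop) Y
        (f ∘ₗ Submodule.inclusion (Ideal.pow_le_pow_right hle)) = 0 := by
      rw [← hmap n _ hle f]
      rw [hi] at hij
      exact hij.trans (map_zero ((D ⋙ ev).map j).hom)
    obtain ⟨m, hm⟩ := exists_eq_smul_of_extOneMap_eq_zero (P k.unop.unop) Y hz
    exact ⟨k.unop.unop, m, fun u hu => hm ⟨u, hu⟩⟩

end Colimit

section DimensionOne

open IsLocalRing

variable {R : Type} [CommRing R]

lemma coheight_anti {I J : Ideal R} (h : I ≤ J) : coheight R J ≤ coheight R I :=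
  Order.krullDim_le_of_strictMono
    (fun p : {p : Ideal R // p.IsPrime ∧ J ≤ p} =>
      (⟨p.1, p.2.1, h.trans p.2.2⟩ : {p : Ideal R // p.IsPrime ∧ I ≤ p}))
    fun _ _ hpq => hpq

lemma one_le_coheight {P Q : Ideal R} [P.IsPrime] [Q.IsPrime] (h : P < Q) :
    1 ≤ coheight R P := by
  let s : LTSeries {p : Ideal R // p.IsPrime ∧ P ≤ p} :=
    { length := 1
      toFun := ![⟨P, ‹_›, le_rfl⟩, ⟨Q, ‹_›, h.le⟩]
      step := fun i => by fin_cases i; exact h }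
  exact le_iSup (fun c : LTSeries _ => (c.length : WithBot ℕ∞)) s

lemma two_le_coheight {I P Q N : Ideal R} [P.IsPrime] [Q.IsPrime] [N.IsPrime] (hI : I ≤ P)
    (hPQ : P < Q) (hQN : Q < N) : 2 ≤ coheight R I := by
  let s : LTSeries {p : Ideal R // p.IsPrime ∧ I ≤ p} :=
    { length := 2
      toFun := ![⟨P, ‹_›, hI⟩, ⟨Q, ‹_›, hI.trans hPQ.le⟩,
        ⟨N, ‹_›, hI.trans (hPQ.trans hQN).le⟩]
      step := fun i => by
        fin_cases i
        exacts [hPQ, hQN] }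
  exact le_iSup (fun c : LTSeries _ => (c.length : WithBot ℕ∞)) s

variable [IsLocalRing R]

lemma coheight_maximalIdeal_le_zero : coheight R (maximalIdeal R) ≤ 0 := by
  have : Subsingleton {p : Ideal R // p.IsPrime ∧ maximalIdeal R ≤ p} :=
    ⟨fun p q => Subtype.ext <| (le_antisymm p.2.2 (le_maximalIdeal p.2.1.ne_top)).symm.trans
      (le_antisymm q.2.2 (le_maximalIdeal q.2.1.ne_top))⟩
  exact Order.krullDim_nonpos_of_subsingleton

variable {M : Type} [AddCommGroup M] [Module R M] (hdim : dimMod R M = 1)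

include hdim

lemma ne_maximalIdeal_of_mem_assh {p : Ideal R} (hp : p ∈ assh R M) : p ≠ maximalIdeal R := by
  rintro rfl
  have h := coheight_maximalIdeal_le_zero (R := R)
  rw [hp.2, hdim] at h
  exact absurd h (by decide)

lemma mem_assh_of_ne_maximalIdeal {P : Ideal R} [hP : P.IsPrime]
    (hle : Module.annihilator R M ≤ P) (hne : P ≠ maximalIdeal R) : P ∈ assh R M :=
  ⟨⟨hP, hle⟩, le_antisymm (coheight_anti hle)
    (hdim.trans_le (one_le_coheight ((le_maximalIdeal hP.ne_top).lt_of_ne hne)))⟩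

lemma eq_of_le_of_mem_assh {p q : Ideal R} [hp : p.IsPrime] (hle : Module.annihilator R M ≤ p)
    (hq : q ∈ assh R M) (hpq : p ≤ q) : p = q := by
  by_contra hne
  have := hq.1.1
  have h := two_le_coheight hle (hpq.lt_of_ne hne)
    ((le_maximalIdeal hq.1.1.ne_top).lt_of_ne (ne_maximalIdeal_of_mem_assh hdim hq))
  change 2 ≤ dimMod R M at h
  rw [hdim] at h
  exact absurd h (by decide)

lemma finite_assh [IsNoetherianRing R] : (assh R M).Finite :=
  (Ideal.finite_minimalPrimes_of_isNoetherianRing R (Module.annihilator R M)).subset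
    fun _ hp => ⟨hp.1, fun _ hq hqp =>
      have := hq.1
      (eq_of_le_of_mem_assh hdim hq.2 hp hqp).ge⟩

end DimensionOne

end Paper

/-- For a one-dimensional finitely generated module `M` over a Noetherian local ring and
any subset `T` of `Assh M`, taking `a` to be the intersection of the primes of
`Assh M \ T` (and `a = m` when `T = Assh M`), the attached primes of `H^1_a(M)` are
exactly `T`. -/
theorem attached_H1_eq (R : Type) [CommRing R] [IsNoetherianRing R] [IsLocalRing R]
    (M : Type) [AddCommGroup M] [Module R M] [Module.Finite R M] [Nontrivial M]
    (hdim : Paper.dimMod R M = 1)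
    (T : Set (Ideal R)) (hT : T ⊆ Paper.assh R M) (a : Ideal R)
    (ha : (T = Paper.assh R M ∧ a = IsLocalRing.maximalIdeal R) ∨
          (T ≠ Paper.assh R M ∧ a = sInf (Paper.assh R M \ T))) :
    Paper.attached R (Paper.H R a 1 M) = T := by
  have hfin := Paper.finite_assh (M := M) hdim
  have hmax : ∀ p ∈ Paper.assh R M, p < IsLocalRing.maximalIdeal R := fun p hp =>
    (IsLocalRing.le_maximalIdeal hp.1.1.ne_top).lt_of_ne
      (Paper.ne_maximalIdeal_of_mem_assh hdim hp)
  have ham : a ≤ IsLocalRing.maximalIdeal R := by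
    rcases ha with ⟨-, rfl⟩ | ⟨hne, rfl⟩
    · exact le_rfl
    · obtain ⟨p, hp⟩ := Set.sdiff_nonempty.2 fun h => hne (hT.antisymm h)
      exact (sInf_le hp).trans (hmax p hp.1).le
  have hle : ∀ p ∈ Paper.assh R M, p ∉ T → a ≤ p := by
    intro p hp hpT
    rcases ha with ⟨rfl, -⟩ | ⟨-, rfl⟩
    · exact absurd hp hpT
    · exact sInf_le ⟨hp, hpT⟩
  have hnle : ∀ p ∈ T, ¬ a ≤ p := by
    intro p hp hap
    rcases ha with ⟨-, rfl⟩ | ⟨-, rfl⟩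
    · exact (hmax p (hT hp)).not_ge hap
    · have := (hT hp).1.1
      obtain ⟨q, hq, hqp⟩ : ∃ q ∈ Paper.assh R M \ T, q ≤ p := by
        have hf := hfin.subset (Set.sdiff_subset (t := T))
        rw [← hf.coe_toFinset, ← Finset.inf_id_eq_sInf, Ideal.IsPrime.inf_le' this] at hap
        obtain ⟨q, hq, hqp⟩ := hap
        exact ⟨q, hf.mem_toFinset.1 hq, hqp⟩
      have := hq.1.1.1
      exact hq.2 (Paper.eq_of_le_of_mem_assh hdim hq.1.1.2 (hT hp) hqp ▸ hp)
  obtain ⟨x, hxa, hxT⟩ : ∃ x ∈ a, ∀ p ∈ T, x ∉ p := by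
    by_contra! h
    have hTf := hfin.subset hT
    have hsub : (a : Set R) ⊆ ⋃ p ∈ (hTf.toFinset : Set (Ideal R)), (p : Set R) := fun x hx => by
      obtain ⟨p, hp, hxp⟩ := h x hx
      exact Set.mem_biUnion (hTf.coe_toFinset.symm ▸ hp) hxp
    obtain ⟨p, hp, hap⟩ := (Ideal.subset_union_prime ⊥ ⊥
      fun p hp _ _ => (hT (hTf.mem_toFinset.1 hp)).1.1).1 hsub
    exact hnle p (hTf.mem_toFinset.1 hp) hap
  have hmem : ∀ P : Ideal R, P.IsPrime → Module.annihilator R M ≤ P → ¬ a ≤ P → P ∈ T := by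
    intro P hP hJP haP
    by_contra hPT
    by_cases hPm : P = IsLocalRing.maximalIdeal R
    · exact haP (hPm ▸ ham)
    · exact haP (hle P (Paper.mem_assh_of_ne_maximalIdeal hdim hJP hPm) hPT)
  have hax : ∀ n, ∃ N, a ^ N ≤ Ideal.span {x ^ n} ⊔ Module.annihilator R M := by
    intro n
    refine Ideal.exists_pow_le_of_le_radical_of_fg ?_ (IsNoetherian.noetherian a)
    rw [Ideal.radical_eq_sInf]
    refine le_sInf fun P ⟨hP, hPprime⟩ => ?_
    by_contra haP
    exact hxT P (hmem P hPprime (le_sup_right.trans hP) haP) (hPprime.mem_of_pow_mem n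
      (hP (Ideal.mem_sup_left (Ideal.mem_span_singleton_self _))))
  obtain ⟨δ, hsurj, hcompat, hker⟩ := Paper.exists_linearMap_H_one a M
  refine Paper.attached_eq_of_surjective_smul (hfin.subset hT) (fun p hp => (hT hp).1.1)
    (fun p hp q hq hpq => ?_) (fun P hP hJP hxP => hmem P hP hJP fun h => hxP (h hxa))
    (fun c hc h => Paper.smul_eq_zero_of_mem_annihilator δ hsurj hc h)
    (fun h => Paper.exists_smul_eq_of_mem δ hsurj hcompat hxa hax h) fun c hc p hp => ?_
  · have := (hT hp).1.1
    exact Paper.eq_of_le_of_mem_assh hdim (hT hp).1.2 (hT hq) hpq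
  · have := (hT hp).1.1
    exact Paper.mem_of_forall_smul_eq_zero δ hker hxa hax
      (IsLocalRing.maximalIdeal_le_jacobson _ (ham hxa)) hc (hT hp).1.2 (hxT p hp)
end
end
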